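/- With notation as in the context, suppose χ_I is a mixed element of homogeneous length r ≥ 3 whose subscript sequence I = (i_1, …, i_r) has a repeated entry (i_s = i_{s+1}). If χ_I satisfies α(χ_I) + β(χ_I) = γ(χ_I) + δ(χ_I), then χ_I = 0. -/

import Mathlib

/-!
Common setup: `B` a commutative ℚ-algebra (playing the role of the coefficient
(graded-)commutative algebra), `ι` an ordered index set for a basis `{w_i}` of an
oddly-graded vector space `W`.  Since `W` is concentrated in odd degrees, the free
graded-commutative algebras `B ⊗ ΛW ⊗ ΛW` and `B ⊗ ΛW ⊗ ΛW ⊗ ΛW` are the exterior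
algebras over `B` on the free modules with bases indexed by `ι ⊕ ι` and `ι ⊕ ι ⊕ ι`.
-/

noncomputable section

variable (B : Type) [CommRing B] [Algebra ℚ B] (ι : Type) [LinearOrder ι]

/-- `B ⊗ ΛW ⊗ ΛW` -/
abbrev TwoFold := ExteriorAlgebra B ((ι ⊕ ι) →₀ B)

/-- `B ⊗ ΛW ⊗ ΛW ⊗ ΛW` -/
abbrev ThreeFold := ExteriorAlgebra B ((ι ⊕ ι ⊕ ι) →₀ B)

variable {B ι}

/-- `w_i`, the generator of the first `ΛW` factor of `B ⊗ ΛW ⊗ ΛW`. -/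
def w (i : ι) : TwoFold B ι := ExteriorAlgebra.ι B (Finsupp.single (Sum.inl i) 1)

/-- `w'_i`, the generator of the second `ΛW` factor of `B ⊗ ΛW ⊗ ΛW`. -/
def w' (i : ι) : TwoFold B ι := ExteriorAlgebra.ι B (Finsupp.single (Sum.inr i) 1)

/-- `w_i` in `B ⊗ ΛW ⊗ ΛW ⊗ ΛW`. -/
def u (i : ι) : ThreeFold B ι := ExteriorAlgebra.ι B (Finsupp.single (Sum.inl i) 1)

/-- `w'_i` in `B ⊗ ΛW ⊗ ΛW ⊗ ΛW`. -/
def u' (i : ι) : ThreeFold B ι := ExteriorAlgebra.ι B (Finsupp.single (Sum.inr (Sum.inl i)) 1)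

/-- `w''_i` in `B ⊗ ΛW ⊗ ΛW ⊗ ΛW`. -/
def u'' (i : ι) : ThreeFold B ι := ExteriorAlgebra.ι B (Finsupp.single (Sum.inr (Sum.inr i)) 1)

/-- The `B`-algebra map `B ⊗ ΛW ⊗ ΛW → B ⊗ ΛW ⊗ ΛW ⊗ ΛW` determined by a choice of
(module-valued) images for the generators `w_i`, `w'_i`. -/
def genMap (g : ι ⊕ ι → (ι ⊕ ι ⊕ ι) →₀ B) : TwoFold B ι →ₐ[B] ThreeFold B ι :=
  ExteriorAlgebra.lift B
    ⟨(ExteriorAlgebra.ι B).comp ((Finsupp.lift ((ι ⊕ ι ⊕ ι) →₀ B) B (ι ⊕ ι)) g),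
     fun m => by simp [ExteriorAlgebra.ι_sq_zero]⟩

/-- `α : w ↦ w, w' ↦ w'`. -/
def mapα : TwoFold B ι →ₐ[B] ThreeFold B ι :=
  genMap (Sum.elim (fun i => Finsupp.single (Sum.inl i) 1)
    (fun i => Finsupp.single (Sum.inr (Sum.inl i)) 1))

/-- `β : w ↦ w + w', w' ↦ w''`. -/
def mapβ : TwoFold B ι →ₐ[B] ThreeFold B ι :=
  genMap (Sum.elim
    (fun i => Finsupp.single (Sum.inl i) 1 + Finsupp.single (Sum.inr (Sum.inl i)) 1)
    (fun i => Finsupp.single (Sum.inr (Sum.inr i)) 1))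

/-- `γ : w ↦ w, w' ↦ w' + w''`. -/
def mapγ : TwoFold B ι →ₐ[B] ThreeFold B ι :=
  genMap (Sum.elim (fun i => Finsupp.single (Sum.inl i) 1)
    (fun i => Finsupp.single (Sum.inr (Sum.inl i)) 1 + Finsupp.single (Sum.inr (Sum.inr i)) 1))

/-- `δ : w ↦ w', w' ↦ w''`. -/
def mapδ : TwoFold B ι →ₐ[B] ThreeFold B ι :=
  genMap (Sum.elim (fun i => Finsupp.single (Sum.inr (Sum.inl i)) 1)
    (fun i => Finsupp.single (Sum.inr (Sum.inr i)) 1))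

/-- The monomial `w^ε_I = w_{i_1}^{ε_1} ⋯ w_{i_r}^{ε_r}`, where `w^0 = w` (first factor)
and `w^1 = w'` (second factor). -/
def mono {r : ℕ} (I : Fin r → ι) (ε : Fin r → Bool) : TwoFold B ι :=
  (List.ofFn fun j => if ε j then w' (I j) else w (I j)).prod

/-- `S_I = (w_{i_1} + w'_{i_1}) ⋯ (w_{i_r} + w'_{i_r})`. -/
def SI {r : ℕ} (I : Fin r → ι) : TwoFold B ι :=
  (List.ofFn fun j => w (I j) + w' (I j)).prod

/-- A general substitution out of the exterior algebra. -/
def substMap {κ : Type} (g : κ → (ι ⊕ ι) →₀ B) :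
    ExteriorAlgebra B (κ →₀ B) →ₐ[B] TwoFold B ι :=
  ExteriorAlgebra.lift B
    ⟨(ExteriorAlgebra.ι B).comp ((Finsupp.lift ((ι ⊕ ι) →₀ B) B κ) g),
     fun m => by simp [ExteriorAlgebra.ι_sq_zero]⟩

theorem substMap_single {κ : Type} (g : κ → (ι ⊕ ι) →₀ B) (k : κ) :
    substMap g (ExteriorAlgebra.ι B (Finsupp.single k 1)) = ExteriorAlgebra.ι B (g k) := by
  simp [substMap]

theorem genMap_single (g : ι ⊕ ι → (ι ⊕ ι ⊕ ι) →₀ B) (k : ι ⊕ ι) :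
    genMap g (ExteriorAlgebra.ι B (Finsupp.single k 1)) = ExteriorAlgebra.ι B (g k) := by
  simp [genMap]

theorem mono_eq_zero {r : ℕ} (I : Fin r → ι) (ε : Fin r → Bool) (j k : Fin r) (hjk : j ≠ k)
    (hI : I j = I k) (hε : ε j = ε k) : (mono I ε : TwoFold B ι) = 0 := by
  have h1 : (mono I ε : TwoFold B ι) = ExteriorAlgebra.ιMulti B r
      (fun j => Finsupp.single (if ε j then Sum.inr (I j) else Sum.inl (I j)) 1) := by
    rw [ExteriorAlgebra.ιMulti_apply, mono]
    congr 2
    funext j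
    split_ifs <;> rfl
  rw [h1]
  exact AlternatingMap.map_eq_zero_of_eq _ _ (by simp [hI, hε]) hjk

theorem map_mono_zero {A : Type} [Ring A] [Algebra B A] (F : TwoFold B ι →ₐ[B] A)
    {r : ℕ} (I : Fin r → ι) (ε : Fin r → Bool) (j : Fin r)
    (h : F (if ε j then w' (I j) else w (I j)) = 0) : F (mono I ε) = 0 := by
  obtain ⟨l₁, l₂, hl⟩ := List.append_of_mem
    ((List.mem_ofFn' (fun j => if ε j then (w' (I j) : TwoFold B ι) else w (I j)) _).2 ⟨j, rfl⟩)
  rw [mono, hl, List.prod_append, List.prod_cons, map_mul, map_mul, h]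
  simp

theorem map_mono_zero_rep {A : Type} [Ring A] [Algebra B A] (F : TwoFold B ι →ₐ[B] A)
    {r : ℕ} (I : Fin r → ι) (ε : Fin r → Bool) (j k : Fin r) (hjk : j ≠ k) (hI : I j = I k)
    (h : F (w (I j)) = 0 ∨ F (w' (I j)) = 0) : F (mono I ε) = 0 := by
  by_cases hε : ε j = ε k
  · rw [mono_eq_zero I ε j k hjk hI hε, map_zero]
  · rcases h with h | h
    · cases hj : ε j
      · exact map_mono_zero F I ε j (by simp [hj, h])
      · have hk : ε k = false := by simpa [hj] using hε
        exact map_mono_zero F I ε k (by simp [hk, ← hI, h])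
    · cases hj : ε j
      · have hk : ε k = true := by simpa [hj] using hε
        exact map_mono_zero F I ε k (by simp [hk, ← hI, h])
      · exact map_mono_zero F I ε j (by simp [hj, h])

/-- Substitution: `x_i ↦ 0, y_i ↦ w_i, z_i ↦ w'_i`, and `x_k ↦ w_k, y_k ↦ 0, z_k ↦ w'_k`. -/
def φ₁ (i : ι) : ThreeFold B ι →ₐ[B] TwoFold B ι :=
  substMap (Sum.elim (fun k => if k = i then 0 else Finsupp.single (Sum.inl k) 1)
    (Sum.elim (fun k => if k = i then Finsupp.single (Sum.inl k) 1 else 0)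
      (fun k => Finsupp.single (Sum.inr k) 1)))

/-- Substitution: `x_i ↦ w_i, y_i ↦ w'_i, z_i ↦ 0`, and `x_k ↦ w_k, y_k ↦ 0, z_k ↦ w'_k`. -/
def φ₂ (i : ι) : ThreeFold B ι →ₐ[B] TwoFold B ι :=
  substMap (Sum.elim (fun k => Finsupp.single (Sum.inl k) 1)
    (Sum.elim (fun k => if k = i then Finsupp.single (Sum.inr k) 1 else 0)
      (fun k => if k = i then 0 else Finsupp.single (Sum.inr k) 1)))

theorem φ₁_β (i : ι) (f : TwoFold B ι) : φ₁ i (mapβ f) = f := by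
  have : (φ₁ i).comp (mapβ (B := B)) = AlgHom.id B _ := by
    ext k
    rcases k with k | k <;> by_cases hk : k = i <;>
      simp [φ₁, mapβ, genMap_single, substMap_single, hk]
  exact DFunLike.congr_fun this f

theorem φ₂_γ (i : ι) (f : TwoFold B ι) : φ₂ i (mapγ f) = f := by
  have : (φ₂ i).comp (mapγ (B := B)) = AlgHom.id B _ := by
    ext k
    rcases k with k | k <;> by_cases hk : k = i <;>
      simp [φ₂, mapγ, genMap_single, substMap_single, hk]
  exact DFunLike.congr_fun this f

/-- Lemma `no repeats`: suppose `χ_I` is a mixed element of homogeneous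
length `r ≥ 3` (the coefficients of the "pure" tuples `ε = (0,…,0)` and `ε = (1,…,1)`
vanish) whose nondecreasing subscript sequence `I` has a repeated entry `I s = I (s+1)`.
If `α(χ_I) + β(χ_I) = γ(χ_I) + δ(χ_I)`, then `χ_I = 0`. -/
theorem stmt6 (r : ℕ) (hr : 3 ≤ r) (I : Fin r → ι) (hI : Monotone I)
    (s : ℕ) (hs : s + 1 < r) (hrep : I ⟨s, by omega⟩ = I ⟨s + 1, hs⟩)
    (a : (Fin r → Bool) → B)
    (hmixed : ∀ ε : Fin r → Bool, ((∀ j, ε j = false) ∨ (∀ j, ε j = true)) → a ε = 0)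
    (h : mapα (∑ ε : Fin r → Bool, a ε • mono I ε : TwoFold B ι) +
        mapβ (∑ ε : Fin r → Bool, a ε • mono I ε) =
      mapγ (∑ ε : Fin r → Bool, a ε • mono I ε) +
        mapδ (∑ ε : Fin r → Bool, a ε • mono I ε)) :
    (∑ ε : Fin r → Bool, a ε • mono I ε : TwoFold B ι) = 0 := by
  set f : TwoFold B ι := ∑ ε : Fin r → Bool, a ε • mono I ε with hf
  have vanish : ∀ F : TwoFold B ι →ₐ[B] TwoFold B ι, (∀ ε, F (mono I ε) = 0) → F f = 0 := by
    intro F hF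
    simp [hf, map_sum, hF]
  set p : Fin r := ⟨s, by omega⟩ with hp
  set q : Fin r := ⟨s + 1, hs⟩ with hq
  have hpq : p ≠ q := by simp [hp, hq]
  have kill : ∀ F : TwoFold B ι →ₐ[B] TwoFold B ι,
      (F (w (I p)) = 0 ∨ F (w' (I p)) = 0) → F f = 0 := fun F hF =>
    vanish F fun ε => map_mono_zero_rep F I ε p q hpq hrep hF
  have h1 : f = φ₁ (I p) (mapδ f) := by
    have e := congrArg (φ₁ (I p)) h
    rw [map_add, map_add, φ₁_β] at e
    have z1 : φ₁ (I p) (mapα f) = 0 := kill ((φ₁ (I p)).comp mapα)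
      (Or.inl (by simp [φ₁, mapα, w, genMap_single, substMap_single]))
    have z2 : φ₁ (I p) (mapγ f) = 0 := kill ((φ₁ (I p)).comp mapγ)
      (Or.inl (by simp [φ₁, mapγ, w, genMap_single, substMap_single]))
    rwa [z1, z2, zero_add, zero_add] at e
  have h2 : φ₂ (I p) (mapα f) = f := by
    have e := congrArg (φ₂ (I p)) h
    rw [map_add, map_add, φ₂_γ] at e
    have z1 : φ₂ (I p) (mapβ f) = 0 := kill ((φ₂ (I p)).comp mapβ)
      (Or.inr (by simp [φ₂, mapβ, w', genMap_single, substMap_single]))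
    have z2 : φ₂ (I p) (mapδ f) = 0 := kill ((φ₂ (I p)).comp mapδ)
      (Or.inr (by simp [φ₂, mapδ, w', genMap_single, substMap_single]))
    rwa [z1, z2, add_zero, add_zero] at e
  have h3 : f = φ₁ (I p) (mapδ (φ₂ (I p) (mapα f))) := by rw [h2]; exact h1
  rw [h3]
  refine vanish ((φ₁ (I p)).comp (mapδ.comp ((φ₂ (I p)).comp mapα))) fun ε => ?_
  -- a third position
  obtain ⟨t, htp, htq⟩ : ∃ t : Fin r, t ≠ p ∧ t ≠ q := by
    by_cases hs0 : s = 0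
    · exact ⟨⟨2, by omega⟩, by simp [hp, hs0], by simp [hq, hs0]⟩
    · exact ⟨⟨0, by omega⟩, by simp [hp]; omega, by simp [hq]⟩
  by_cases ht : I t = I p
  · have hz : (mono I ε : TwoFold B ι) = 0 := by
      by_cases e1 : ε p = ε q
      · exact mono_eq_zero I ε p q hpq hrep e1
      · by_cases e2 : ε t = ε p
        · exact mono_eq_zero I ε t p htp ht e2
        · refine mono_eq_zero I ε t q htq (ht.trans hrep) ?_
          revert e1 e2
          cases ε p <;> cases ε q <;> cases ε t <;> simp
    rw [hz, map_zero]
  · refine map_mono_zero _ I ε t ?_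
    cases hε : ε t <;>
      simp [φ₁, φ₂, mapα, mapδ, w, w', genMap_single, substMap_single, ht]
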